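/- arXiv:2003.02815 — 4 statements merged into one kernel-verified Lean document; each statement's English description precedes it below -/
import Mathlib

section
/- Fix a point of U and let N ∈ ℝ^4 satisfy g(N,B) = -1 and g(N,N) < 0. Set ν := √(-g(N,N)) > 0, N̂ := N/ν, Π̃^α_β := δ^α_β + N̂^α N̂_β, g̃_{αβ} := g_{αβ} + N̂_α N̂_β, (g̃^{-1})^{αβ} := (g^{-1})^{αβ} + N̂^α N̂^β, and K^α := ν Π̃^α_β B^β. Then: (i) K = ν B - N̂; (ii) g̃(K,K) := g̃_{αβ} K^α K^β = 1 - ν², and in particular g̃(K,K) < 1; and (iii) (g̃^{-1})^{αβ} = (ğ^{-1})^{αβ} + K^α K^β - ν B^α K^β - ν K^α B^β - (1-ν²) B^α B^β, where (ğ^{-1})^{αβ} := (g^{-1})^{αβ} + B^α B^β is the inverse first fundamental form of Σ_t. -/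
noncomputable section

open scoped BigOperators

/-- The set of spatial indices `{1,2,3} ⊆ Fin 4`. -/
def spIdx : Finset (Fin 4) := {1, 2, 3}

/-- The components `g_{αβ}` of the acoustical metric determined by the sound
speed `c` and the velocity components `v` at a point (recall `v 0 = 0`):
`g_{00} = -1 + c⁻² Σₐ (vᵃ)²`, `g_{0i} = g_{i0} = -c⁻² vⁱ`, `g_{ij} = c⁻² δ_{ij}`. -/
def gmet (c : ℝ) (v : Fin 4 → ℝ) (α β : Fin 4) : ℝ :=
  if α = 0 then
    if β = 0 then -1 + (∑ a ∈ spIdx, v a ^ 2) / c ^ 2 else -v β / c ^ 2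
  else
    if β = 0 then -v α / c ^ 2 else (if α = β then (1 : ℝ) else 0) / c ^ 2

/-- The components of the inverse acoustical metric:
`G^{00} = -1`, `G^{0i} = G^{i0} = -vⁱ`, `G^{ij} = c² δ^{ij} - vⁱ vʲ`. -/
def ginv (c : ℝ) (v : Fin 4 → ℝ) (α β : Fin 4) : ℝ :=
  if α = 0 then
    if β = 0 then -1 else -v β
  else
    if β = 0 then -v α else c ^ 2 * (if α = β then (1 : ℝ) else 0) - v α * v β

/-- The material vectorfield `B = (1, v¹, v², v³)` (recall `v 0 = 0`). -/
def Bvec (v : Fin 4 → ℝ) (α : Fin 4) : ℝ := (if α = 0 then (1 : ℝ) else 0) + v α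

/-- The inner product `g(X,Y) = g_{αβ} X^α Y^β`. -/
def gip (c : ℝ) (v : Fin 4 → ℝ) (X Y : Fin 4 → ℝ) : ℝ :=
  ∑ α : Fin 4, ∑ β : Fin 4, gmet c v α β * X α * Y β

/-- Index lowering with `g`:  `X_α = g_{αβ} X^β`. -/
def glow (c : ℝ) (v : Fin 4 → ℝ) (X : Fin 4 → ℝ) (α : Fin 4) : ℝ :=
  ∑ β : Fin 4, gmet c v α β * X β

/-- The partial derivative `∂_α f` at `x`. -/
def pd (f : (Fin 4 → ℝ) → ℝ) (α : Fin 4) (x : Fin 4 → ℝ) : ℝ :=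
  fderiv ℝ f x (Pi.single α 1)

/-- The totally antisymmetric symbol `ε_{αβγδ}`, normalized by `ε_{0123} = 1`. -/
def eps4 (α β γ δ : Fin 4) : ℝ :=
  (((β : ℕ) : ℝ) - ((α : ℕ) : ℝ)) * (((γ : ℕ) : ℝ) - ((α : ℕ) : ℝ)) *
    (((δ : ℕ) : ℝ) - ((α : ℕ) : ℝ)) * (((γ : ℕ) : ℝ) - ((β : ℕ) : ℝ)) *
    (((δ : ℕ) : ℝ) - ((β : ℕ) : ℝ)) * (((δ : ℕ) : ℝ) - ((γ : ℕ) : ℝ)) / 12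

/-- The spatial totally antisymmetric symbol `ε_{ijk}` (vanishing unless all
indices lie in `{1,2,3}`), normalized by `ε_{123} = 1`. -/
def eps3 (i j k : Fin 4) : ℝ := eps4 0 i j k

theorem gmet_symm (c : ℝ) (v : Fin 4 → ℝ) (α β : Fin 4) : gmet c v α β = gmet c v β α := by
  fin_cases α <;> fin_cases β <;> simp [gmet]

theorem gip_symm (c : ℝ) (v X Y : Fin 4 → ℝ) : gip c v X Y = gip c v Y X := by
  unfold gip
  rw [Finset.sum_comm]
  refine Finset.sum_congr rfl fun α _ => Finset.sum_congr rfl fun β _ => ?_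
  rw [gmet_symm c v β α]
  ring

theorem gip_smul_sub_left (c : ℝ) (v X Y Z : Fin 4 → ℝ) (a : ℝ) :
    gip c v (fun α => a * X α - Y α) Z = a * gip c v X Z - gip c v Y Z := by
  simp only [gip, Finset.mul_sum, ← Finset.sum_sub_distrib]
  refine Finset.sum_congr rfl fun α _ => Finset.sum_congr rfl fun β _ => ?_
  ring

theorem gip_div_left (c : ℝ) (v X Y : Fin 4 → ℝ) (a : ℝ) :
    gip c v (fun α => X α / a) Y = gip c v X Y / a := by
  simp only [gip, Finset.sum_div]
  refine Finset.sum_congr rfl fun α _ => Finset.sum_congr rfl fun β _ => ?_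
  ring

theorem sum_glow_mul (c : ℝ) (v X Y : Fin 4 → ℝ) :
    ∑ β : Fin 4, glow c v X β * Y β = gip c v X Y := by
  rw [gip_symm]
  simp only [gip, glow, Finset.sum_mul]
  refine Finset.sum_congr rfl fun α _ => Finset.sum_congr rfl fun β _ => ?_
  ring

/-- The material vectorfield is `g`-unit timelike. -/
theorem gip_Bvec_self (c : ℝ) (v : Fin 4 → ℝ) (hv0 : v 0 = 0) :
    gip c v (Bvec v) (Bvec v) = -1 := by
  simp [gip, gmet, Bvec, spIdx, Fin.sum_univ_four, hv0]
  ring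

/-- The projection `Π̃` applied to `Y`, contracted: `Y + g(X,Y) X`. -/
theorem sum_projection_mul (c : ℝ) (v X Y : Fin 4 → ℝ) (α : Fin 4) :
    ∑ β : Fin 4, ((if α = β then (1 : ℝ) else 0) + X α * glow c v X β) * Y β
      = Y α + X α * gip c v X Y := by
  simp only [← sum_glow_mul, add_mul, Finset.sum_add_distrib, Finset.mul_sum, mul_assoc,
    ite_mul, one_mul, zero_mul, Finset.sum_ite_eq, Finset.mem_univ, if_true]

/-- The first fundamental form `g + X ⊗ X` evaluated on `(Y,Y)`. -/
theorem sum_firstFundamentalForm (c : ℝ) (v X Y : Fin 4 → ℝ) :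
    ∑ α : Fin 4, ∑ β : Fin 4, (gmet c v α β + glow c v X α * glow c v X β) * Y α * Y β
      = gip c v Y Y + gip c v X Y ^ 2 := by
  rw [← sum_glow_mul c v X Y, sq, Finset.sum_mul_sum, gip, ← Finset.sum_add_distrib]
  refine Finset.sum_congr rfl fun α _ => ?_
  rw [← Finset.sum_add_distrib]
  refine Finset.sum_congr rfl fun β _ => ?_
  ring

/-- With `ν := √(-g(N,N))`, `N̂ := N/ν`, and
`K^α := ν Π̃^α_β B^β`: (i) `K = νB - N̂`; (ii) `g̃(K,K) = 1 - ν² < 1`;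
(iii) `(g̃⁻¹)^{αβ} = (ğ⁻¹)^{αβ} + K^αK^β - νB^αK^β - νK^αB^β - (1-ν²)B^αB^β`,
where `(ğ⁻¹)^{αβ} = (g⁻¹)^{αβ} + B^αB^β`. -/
theorem stmt6_projected_material_vectorfield_identities
    (c : ℝ) (v N : Fin 4 → ℝ) (hc : 0 < c) (hv0 : v 0 = 0)
    (hNB : gip c v N (Bvec v) = -1) (hNN : gip c v N N < 0)
    (ν : ℝ) (hν : ν = Real.sqrt (-gip c v N N))
    (Nh : Fin 4 → ℝ) (hNh : Nh = fun α => N α / ν)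
    (K : Fin 4 → ℝ)
    (hK : K = fun α => ν * ∑ β : Fin 4,
      ((if α = β then (1 : ℝ) else 0) + Nh α * glow c v Nh β) * Bvec v β) :
    (∀ α : Fin 4, K α = ν * Bvec v α - Nh α) ∧
    (∑ α : Fin 4, ∑ β : Fin 4,
        (gmet c v α β + glow c v Nh α * glow c v Nh β) * K α * K β = 1 - ν ^ 2) ∧
    (∑ α : Fin 4, ∑ β : Fin 4,
        (gmet c v α β + glow c v Nh α * glow c v Nh β) * K α * K β < 1) ∧
    ∀ α β : Fin 4,
      ginv c v α β + Nh α * Nh β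
        = (ginv c v α β + Bvec v α * Bvec v β) + K α * K β
          - ν * Bvec v α * K β - ν * K α * Bvec v β
          - (1 - ν ^ 2) * Bvec v α * Bvec v β := by
  have hpos : 0 < ν := hν ▸ Real.sqrt_pos.mpr (neg_pos.mpr hNN)
  have hsq : gip c v N N = -ν ^ 2 := by
    rw [hν, Real.sq_sqrt (neg_pos.mpr hNN).le, neg_neg]
  have hBB := gip_Bvec_self c v hv0
  have hNhB : gip c v Nh (Bvec v) = -1 / ν := by rw [hNh, gip_div_left, hNB]
  have hNhNh : gip c v Nh Nh = -1 := by
    rw [hNh, gip_div_left, gip_symm, gip_div_left, hsq]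
    field_simp
  have hKeq : K = fun α => ν * Bvec v α - Nh α := by
    funext α
    rw [hK]
    simp only [sum_projection_mul, hNhB]
    field_simp
    ring
  have hNhK : gip c v Nh K = 0 := by
    rw [gip_symm, hKeq, gip_smul_sub_left, gip_symm, hNhB, hNhNh]
    field_simp
    ring
  have hBK : gip c v (Bvec v) K = -ν + 1 / ν := by
    rw [gip_symm, hKeq, gip_smul_sub_left, hBB, hNhB]
    ring
  have hKK : gip c v K K = 1 - ν ^ 2 := by
    calc gip c v K K = ν * gip c v (Bvec v) K - gip c v Nh K := by
          rw [← gip_smul_sub_left, ← hKeq]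
      _ = 1 - ν ^ 2 := by
          rw [hBK, hNhK]
          field_simp
          ring
  have hform := sum_firstFundamentalForm c v Nh K
  rw [hKK, hNhK, zero_pow two_ne_zero, add_zero] at hform
  refine ⟨fun α => congrFun hKeq α, hform, ?_, fun α β => ?_⟩
  · rw [hform]
    linarith [pow_pos hpos 2]
  · simp only [hKeq]
    ring
end
end

section
/- Let N be a smooth vectorfield on U with g(N,B) = -1 and g(N,N) < 0 everywhere; define ν := √(-g(N,N)), N̂ := N/ν, Π̃^α_β := δ^α_β + N̂^α N̂_β, g̃_{αβ} := g_{αβ} + N̂_α N̂_β, (g̃^{-1})^{αβ} := (g^{-1})^{αβ} + N̂^α N̂^β, and K := ν B - N̂, and let Q be the quadratic form on real 4×4 arrays U = (U^β{}_α) given by Q(U,U) := |Π̃U|²_{g̃} - (K_β K^α U^β{}_α)² + g̃_{γδ} (B^α U^γ{}_α)(B^β U^δ{}_β) + (g̃^{-1})^{αβ} (B_γ U^γ{}_α)(B_δ U^δ{}_β) + (B_β B^α U^β{}_α)², where (Π̃U)^δ{}_γ := Π̃^δ_β Π̃^α_γ U^β{}_α and |T|²_{g̃} := g̃_{δκ}(g̃^{-1})^{γλ}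 T^δ{}_γ T^κ{}_λ. Then for every smooth Σ_t-tangent vectorfield V on U (V^0 ≡ 0), taking U^β{}_α := ∂_α V^β one has at every point: Q(∂V,∂V) = |Π̃(∂V)|²_{g̃} - (K_α (K^μ ∂_μ V^α))² + g̃_{αβ} (B^μ ∂_μ V^α)(B^ν ∂_ν V^β). -/
noncomputable section

open scoped BigOperators

/-- `ν = √(-g(N,N))`. -/
def nuP (c : ℝ) (v N : Fin 4 → ℝ) : ℝ := Real.sqrt (-gip c v N N)

/-- The unit normal `N̂ = N/ν`. -/
def nhat (c : ℝ) (v N : Fin 4 → ℝ) (α : Fin 4) : ℝ := N α / nuP c v N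

/-- The first fundamental form `g̃_{αβ} = g_{αβ} + N̂_α N̂_β`. -/
def gtmet (c : ℝ) (v N : Fin 4 → ℝ) (α β : Fin 4) : ℝ :=
  gmet c v α β + glow c v (nhat c v N) α * glow c v (nhat c v N) β

/-- The inverse first fundamental form `(g̃⁻¹)^{αβ} = (g⁻¹)^{αβ} + N̂^α N̂^β`. -/
def gtinv (c : ℝ) (v N : Fin 4 → ℝ) (α β : Fin 4) : ℝ :=
  ginv c v α β + nhat c v N α * nhat c v N β

/-- The projection `Π̃^α_β = δ^α_β + N̂^α N̂_β`. -/
def projT (c : ℝ) (v N : Fin 4 → ℝ) (α β : Fin 4) : ℝ :=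
  (if α = β then (1 : ℝ) else 0) + nhat c v N α * glow c v (nhat c v N) β

/-- The vectorfield `K = νB - N̂`. -/
def Kvec (c : ℝ) (v N : Fin 4 → ℝ) (α : Fin 4) : ℝ :=
  nuP c v N * Bvec v α - nhat c v N α

/-- The projection `(Π̃U)^δ{}_γ = Π̃^δ_β Π̃^α_γ U^β{}_α` of a `(1,1)`-array. -/
def projMat (c : ℝ) (v N : Fin 4 → ℝ) (M : Matrix (Fin 4) (Fin 4) ℝ) (δ γ : Fin 4) : ℝ :=
  ∑ β : Fin 4, ∑ α : Fin 4, projT c v N δ β * projT c v N α γ * M β α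

/-- The squared seminorm `|T|²_g̃ = g̃_{δκ} (g̃⁻¹)^{γμ} T^δ{}_γ T^κ{}_μ`. -/
def gtNormSq (c : ℝ) (v N : Fin 4 → ℝ) (T : Fin 4 → Fin 4 → ℝ) : ℝ :=
  ∑ δ : Fin 4, ∑ κ : Fin 4, ∑ γ : Fin 4, ∑ μ : Fin 4,
    gtmet c v N δ κ * gtinv c v N γ μ * T δ γ * T κ μ

/-- The solution-adapted quadratic form `Q` acting on `(1,1)`-arrays
`U^β{}_α` (encoded as `M β α`):
`Q(U,U) = |Π̃U|²_g̃ - (K_β K^α U^β{}_α)² + g̃_{γδ}(B^αU^γ{}_α)(B^βU^δ{}_β)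
 + (g̃⁻¹)^{αβ}(B_γU^γ{}_α)(B_δU^δ{}_β) + (B_βB^αU^β{}_α)²`. -/
def Qform (c : ℝ) (v N : Fin 4 → ℝ) (M : Matrix (Fin 4) (Fin 4) ℝ) : ℝ :=
  gtNormSq c v N (projMat c v N M)
  - (∑ β : Fin 4, ∑ α : Fin 4, glow c v (Kvec c v N) β * Kvec c v N α * M β α) ^ 2
  + (∑ γ : Fin 4, ∑ δ : Fin 4, gtmet c v N γ δ *
      (∑ α : Fin 4, Bvec v α * M γ α) * (∑ β : Fin 4, Bvec v β * M δ β))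
  + (∑ α : Fin 4, ∑ β : Fin 4, gtinv c v N α β *
      (∑ γ : Fin 4, glow c v (Bvec v) γ * M γ α) *
      (∑ δ : Fin 4, glow c v (Bvec v) δ * M δ β))
  + (∑ β : Fin 4, ∑ α : Fin 4, glow c v (Bvec v) β * Bvec v α * M β α) ^ 2

/-- The material vectorfield has lowered components `B_α = -δ^0_α`. -/
theorem glow_Bvec (c : ℝ) {v : Fin 4 → ℝ} (hv : v 0 = 0) (α : Fin 4) :
    glow c v (Bvec v) α = if α = 0 then -1 else 0 := by
  fin_cases α <;> simp [glow, gmet, Bvec, spIdx, Fin.sum_univ_four, hv] <;> ring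

/-- The partial derivatives of a function vanishing on an open set vanish there. -/
theorem pd_eq_zero_of_eqOn_zero {U : Set (Fin 4 → ℝ)} (hU : IsOpen U)
    {f : (Fin 4 → ℝ) → ℝ} (hf : ∀ x ∈ U, f x = 0) {x : Fin 4 → ℝ} (hx : x ∈ U) (α : Fin 4) :
    pd f α x = 0 := by
  have h : f =ᶠ[nhds x] fun _ => 0 := Filter.eventuallyEq_of_mem (hU.mem_nhds hx) hf
  simp [pd, h.fderiv_eq]

/-- If `U^0{}_α = 0`, the terms of `Q` in which `B_β` is contracted with `U^β{}_α` drop out. -/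
theorem Qform_eq_of_row_zero (c : ℝ) {v : Fin 4 → ℝ} (N : Fin 4 → ℝ)
    {M : Matrix (Fin 4) (Fin 4) ℝ} (hv : v 0 = 0) (hM : ∀ α, M 0 α = 0) :
    Qform c v N M = gtNormSq c v N (projMat c v N M)
      - (∑ α : Fin 4, glow c v (Kvec c v N) α * ∑ μ : Fin 4, Kvec c v N μ * M α μ) ^ 2
      + ∑ α : Fin 4, ∑ β : Fin 4, gtmet c v N α β *
          (∑ μ : Fin 4, Bvec v μ * M α μ) * (∑ μ : Fin 4, Bvec v μ * M β μ) := by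
  simp only [Qform, glow_Bvec c hv, Finset.mul_sum, mul_assoc]
  simp [hM, ite_mul]

/-- For a smooth `Σ_t`-tangent vectorfield `V`, taking
`U^β{}_α := ∂_α V^β` one has
`Q(∂V,∂V) = |Π̃(∂V)|²_g̃ - (K_α(K^μ∂_μV^α))² + g̃_{αβ}(B^μ∂_μV^α)(B^ν∂_νV^β)`. -/
theorem stmt9_Qform_of_gradient_of_tangent_vectorfield
    (U : Set (Fin 4 → ℝ)) (hUopen : IsOpen U) (hUne : U.Nonempty)
    (v : (Fin 4 → ℝ) → Fin 4 → ℝ) (c : (Fin 4 → ℝ) → ℝ)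
    (hv : ContDiffOn ℝ (⊤ : ℕ∞) v U) (hc : ContDiffOn ℝ (⊤ : ℕ∞) c U)
    (hv0 : ∀ x, v x 0 = 0) (hcpos : ∀ x ∈ U, 0 < c x)
    (N : (Fin 4 → ℝ) → Fin 4 → ℝ) (hN : ContDiffOn ℝ (⊤ : ℕ∞) N U)
    (hNB : ∀ x ∈ U, gip (c x) (v x) (N x) (Bvec (v x)) = -1)
    (hNN : ∀ x ∈ U, gip (c x) (v x) (N x) (N x) < 0)
    (V : (Fin 4 → ℝ) → Fin 4 → ℝ) (hV : ContDiffOn ℝ (⊤ : ℕ∞) V U)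
    (hV0 : ∀ x ∈ U, V x 0 = 0) :
    ∀ x ∈ U,
      Qform (c x) (v x) (N x) (Matrix.of fun β α => pd (fun y => V y β) α x)
      = gtNormSq (c x) (v x) (N x)
          (projMat (c x) (v x) (N x) (Matrix.of fun β α => pd (fun y => V y β) α x))
        - (∑ α : Fin 4, glow (c x) (v x) (Kvec (c x) (v x) (N x)) α *
            ∑ μ : Fin 4, Kvec (c x) (v x) (N x) μ * pd (fun y => V y α) μ x) ^ 2
        + ∑ α : Fin 4, ∑ β : Fin 4, gtmet (c x) (v x) (N x) α β *
            (∑ μ : Fin 4, Bvec (v x) μ * pd (fun y => V y α) μ x) *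
            (∑ μ : Fin 4, Bvec (v x) μ * pd (fun y => V y β) μ x) := by
  intro x hx
  exact Qform_eq_of_row_zero (c x) (N x) (hv0 x)
    fun α => pd_eq_zero_of_eqOn_zero hUopen hV0 hx α
end
end

section
/- For smooth solutions (ρ, v, s) of the compressible Euler equations on U, the exterior derivative of the g-dual of the specific vorticity satisfies, for all α, β ∈ {0,1,2,3} and at every point of U: ∂_α Ω_β - ∂_β Ω_α = 2(∂_β ln c) Ω_α - 2(∂_α ln c) Ω_β + 2 δ_α^0 Ω_a ∂_β v^a - 2 δ_β^0 Ω_a ∂_α v^a - c^{-4} e^{-2ρ} (p_{;s}/ϱ̄) ε_{αβγδ} (B^μ ∂_μ v^γ) S^δ + c^{-4} e^{-2ρ} (p_{;s}/ϱ̄) ε_{αβγδ} B^γ [ S^δ (∂_a v^a) - S^a ∂_a v^δ ] + c^{-2} e^{ρ} ε_{αβγδ} B^γ C^δ, where Ω_α := g_{αμ} Ω^μ. -/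
noncomputable section

open scoped BigOperators

theorem pd_mul {f h : (Fin 4 → ℝ) → ℝ} {x : Fin 4 → ℝ} (hf : DifferentiableAt ℝ f x)
    (hh : DifferentiableAt ℝ h x) (α : Fin 4) :
    pd (fun y => f y * h y) α x = pd f α x * h x + f x * pd h α x := by
  simp only [pd, fderiv_fun_mul hf hh, add_apply,
    smul_apply, smul_eq_mul]
  ring

theorem pd_add {f h : (Fin 4 → ℝ) → ℝ} {x : Fin 4 → ℝ} (hf : DifferentiableAt ℝ f x)
    (hh : DifferentiableAt ℝ h x) (α : Fin 4) :
    pd (fun y => f y + h y) α x = pd f α x + pd h α x := by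
  simp [pd, fderiv_fun_add hf hh]

theorem pd_sub {f h : (Fin 4 → ℝ) → ℝ} {x : Fin 4 → ℝ} (hf : DifferentiableAt ℝ f x)
    (hh : DifferentiableAt ℝ h x) (α : Fin 4) :
    pd (fun y => f y - h y) α x = pd f α x - pd h α x := by
  simp [pd, fderiv_fun_sub hf hh]

theorem pd_sum {ι : Type*} (u : Finset ι) {f : ι → (Fin 4 → ℝ) → ℝ} {x : Fin 4 → ℝ}
    (hf : ∀ μ ∈ u, DifferentiableAt ℝ (f μ) x) (α : Fin 4) :
    pd (fun y => ∑ μ ∈ u, f μ y) α x = ∑ μ ∈ u, pd (f μ) α x := by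
  simp [pd, fderiv_fun_sum hf]

theorem pd_comp {φ : ℝ → ℝ} {φ' : ℝ} {f : (Fin 4 → ℝ) → ℝ} {x : Fin 4 → ℝ}
    (hφ : HasDerivAt φ φ' (f x)) (hf : DifferentiableAt ℝ f x) (α : Fin 4) :
    pd (fun y => φ (f y)) α x = φ' * pd f α x := by
  have h := (hφ.comp_hasFDerivAt x hf.hasFDerivAt).fderiv
  simp only [Function.comp_def] at h
  simp [pd, h]

theorem pd_congr_of_isOpen {U : Set (Fin 4 → ℝ)} (hU : IsOpen U) {f h : (Fin 4 → ℝ) → ℝ}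
    (hfh : ∀ y ∈ U, f y = h y) {x : Fin 4 → ℝ} (hx : x ∈ U) (α : Fin 4) :
    pd f α x = pd h α x := by
  have : f =ᶠ[nhds x] h := Filter.eventuallyEq_of_mem (hU.mem_nhds hx) hfh
  simp [pd, this.fderiv_eq]

theorem contDiffOn_pd {U : Set (Fin 4 → ℝ)} (hU : IsOpen U) {f : (Fin 4 → ℝ) → ℝ}
    (hf : ContDiffOn ℝ (⊤ : ℕ∞) f U) (α : Fin 4) : ContDiffOn ℝ (⊤ : ℕ∞) (pd f α) U :=
  (hf.fderiv_of_isOpen hU (m := (⊤ : ℕ∞)) (by simp)).clm_apply contDiffOn_const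

theorem differentiableAt_of_contDiffOn_top {U : Set (Fin 4 → ℝ)} (hU : IsOpen U)
    {f : (Fin 4 → ℝ) → ℝ} (hf : ContDiffOn ℝ (⊤ : ℕ∞) f U) {x : Fin 4 → ℝ} (hx : x ∈ U) :
    DifferentiableAt ℝ f x :=
  (hf.contDiffAt (hU.mem_nhds hx)).differentiableAt (by simp)

theorem pd_comm {U : Set (Fin 4 → ℝ)} (hU : IsOpen U) {f : (Fin 4 → ℝ) → ℝ}
    (hf : ContDiffOn ℝ (⊤ : ℕ∞) f U) {x : Fin 4 → ℝ} (hx : x ∈ U) (α β : Fin 4) :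
    pd (pd f α) β x = pd (pd f β) α x := by
  have hsymm : IsSymmSndFDerivAt ℝ f x :=
    (hf.contDiffAt (hU.mem_nhds hx)).isSymmSndFDerivAt (by
      simpa using WithTop.coe_le_coe.2 (le_top : (2 : ℕ∞) ≤ ⊤))
  have hd : DifferentiableAt ℝ (fderiv ℝ f) x :=
    (((hf.contDiffAt (hU.mem_nhds hx)).fderiv_right (m := (⊤ : ℕ∞)) (by simp))).differentiableAt
      (by simp)
  have hpd (γ δ : Fin 4) : pd (pd f γ) δ x =
      fderiv ℝ (fderiv ℝ f) x (Pi.single δ 1) (Pi.single γ 1) := by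
    have : pd f γ = fun y => fderiv ℝ f y (Pi.single γ 1) := rfl
    rw [this, pd, fderiv_clm_apply hd (differentiableAt_const _)]
    simp
  rw [hpd, hpd]
  exact hsymm _ _

theorem pd_comp₂ {p : ℝ → ℝ → ℝ} {f h : (Fin 4 → ℝ) → ℝ} {x : Fin 4 → ℝ}
    (hp : DifferentiableAt ℝ (fun q : ℝ × ℝ => p q.1 q.2) (f x, h x))
    (hf : DifferentiableAt ℝ f x) (hh : DifferentiableAt ℝ h x) (α : Fin 4) :
    pd (fun y => p (f y) (h y)) α x
      = deriv (fun r => p r (h x)) (f x) * pd f α x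
        + deriv (fun t => p (f x) t) (h x) * pd h α x := by
  set L := fderiv ℝ (fun q : ℝ × ℝ => p q.1 q.2) (f x, h x) with hL
  have hfst : deriv (fun r => p r (h x)) (f x) = L (1, 0) := by
    have := hp.hasFDerivAt.comp_hasDerivAt (f x)
      ((hasDerivAt_id (f x)).prodMk (hasDerivAt_const (f x) (h x)))
    exact this.deriv
  have hsnd : deriv (fun t => p (f x) t) (h x) = L (0, 1) := by
    have := hp.hasFDerivAt.comp_hasDerivAt (h x)
      ((hasDerivAt_const (h x) (f x)).prodMk (hasDerivAt_id (h x)))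
    exact this.deriv
  have hchain := (hp.hasFDerivAt.comp x (hf.hasFDerivAt.prodMk hh.hasFDerivAt)).fderiv
  simp only [Function.comp_def] at hchain
  rw [hfst, hsnd, pd, hchain]
  set a := pd f α x
  set b := pd h α x
  have : ((a, b) : ℝ × ℝ) = a • ((1, 0) : ℝ × ℝ) + b • ((0, 1) : ℝ × ℝ) := by simp
  change L (a, b) = _
  rw [this, map_add, map_smul, map_smul, smul_eq_mul, smul_eq_mul]
  ring

theorem contDiffOn_deriv_fst {p : ℝ → ℝ → ℝ}
    (hp : ContDiffOn ℝ (⊤ : ℕ∞) (fun q : ℝ × ℝ => p q.1 q.2)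
      (Set.Ioi (0 : ℝ) ×ˢ (Set.univ : Set ℝ))) :
    ContDiffOn ℝ (⊤ : ℕ∞) (fun q : ℝ × ℝ => deriv (fun r => p r q.2) q.1)
      (Set.Ioi (0 : ℝ) ×ˢ (Set.univ : Set ℝ)) := by
  have hO : IsOpen (Set.Ioi (0 : ℝ) ×ˢ (Set.univ : Set ℝ)) := isOpen_Ioi.prod isOpen_univ
  refine ((hp.fderiv_of_isOpen hO (m := (⊤ : ℕ∞)) (by simp)).clm_apply
    (contDiffOn_const (c := ((1, 0) : ℝ × ℝ)))).congr fun q hq => ?_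
  have hd : DifferentiableAt ℝ (fun q : ℝ × ℝ => p q.1 q.2) (q.1, q.2) :=
    (hp.contDiffAt (hO.mem_nhds hq)).differentiableAt (by simp)
  have := hd.hasFDerivAt.comp_hasDerivAt q.1
    ((hasDerivAt_id q.1).prodMk (hasDerivAt_const q.1 q.2))
  exact this.deriv

theorem glow_of_ne_zero (c : ℝ) (v X : Fin 4 → ℝ) (hX : X 0 = 0) {i : Fin 4} (hi : i ≠ 0) :
    glow c v X i = X i * (c ^ 2)⁻¹ := by
  fin_cases i <;> simp_all [glow, gmet, Fin.sum_univ_four, mul_comm]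

theorem eps4_swap (α β γ δ : Fin 4) : eps4 β α γ δ = -eps4 α β γ δ := by
  simp only [eps4]; ring

theorem eps4_self (α γ δ : Fin 4) : eps4 α α γ δ = 0 := by
  simp [eps4]

/-- `(i, j, k)` is a cyclic permutation of `(1, 2, 3)`. -/
def IsCyclicTriple (i j k : Fin 4) : Prop :=
  (i = 1 ∧ j = 2 ∧ k = 3) ∨ (i = 2 ∧ j = 3 ∧ k = 1) ∨ (i = 3 ∧ j = 1 ∧ k = 2)

namespace IsCyclicTriple

variable {i j k : Fin 4}

theorem rotate (h : IsCyclicTriple i j k) : IsCyclicTriple j k i := by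
  unfold IsCyclicTriple at *
  tauto

theorem ne_zero (h : IsCyclicTriple i j k) : i ≠ 0 := by
  rcases h with ⟨rfl, rfl, rfl⟩ | ⟨rfl, rfl, rfl⟩ | ⟨rfl, rfl, rfl⟩ <;> decide

theorem sum_univ (h : IsCyclicTriple i j k) (f : Fin 4 → ℝ) :
    ∑ a, f a = f 0 + f i + f j + f k := by
  rcases h with ⟨rfl, rfl, rfl⟩ | ⟨rfl, rfl, rfl⟩ | ⟨rfl, rfl, rfl⟩ <;>
    simp only [Fin.sum_univ_four] <;> ring

theorem sum_spIdx (h : IsCyclicTriple i j k) (f : Fin 4 → ℝ) :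
    ∑ a ∈ spIdx, f a = f i + f j + f k := by
  have h0 : spIdx = {1, 2, 3} := rfl
  rcases h with ⟨rfl, rfl, rfl⟩ | ⟨rfl, rfl, rfl⟩ | ⟨rfl, rfl, rfl⟩ <;> simp [h0] <;> ring

theorem sum_eps3 (h : IsCyclicTriple i j k) (X : Fin 4 → Fin 4 → ℝ) :
    ∑ a, ∑ b, eps3 i a b * X a b = X j k - X k j := by
  rcases h with ⟨rfl, rfl, rfl⟩ | ⟨rfl, rfl, rfl⟩ | ⟨rfl, rfl, rfl⟩ <;>
    simp [eps3, eps4, Fin.sum_univ_four] <;> ring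

theorem sum_eps4_zero (h : IsCyclicTriple i j k) (X : Fin 4 → Fin 4 → ℝ) :
    ∑ γ, ∑ δ, eps4 0 i γ δ * X γ δ = X j k - X k j := by
  simpa only [eps3] using h.sum_eps3 X

theorem sum_eps4 (h : IsCyclicTriple i j k) (X : Fin 4 → Fin 4 → ℝ) :
    ∑ γ, ∑ δ, eps4 j k γ δ * X γ δ = X 0 i - X i 0 := by
  rcases h with ⟨rfl, rfl, rfl⟩ | ⟨rfl, rfl, rfl⟩ | ⟨rfl, rfl, rfl⟩ <;>
    simp [eps4, Fin.sum_univ_four] <;> ring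

theorem glow_zero (h : IsCyclicTriple i j k) (c : ℝ) (v X : Fin 4 → ℝ) (hX : X 0 = 0) :
    glow c v X 0 = -(v i * X i + v j * X j + v k * X k) * (c ^ 2)⁻¹ := by
  rcases h with ⟨rfl, rfl, rfl⟩ | ⟨rfl, rfl, rfl⟩ | ⟨rfl, rfl, rfl⟩ <;>
    simp [glow, gmet, Fin.sum_univ_four, hX] <;> ring

/-- To prove a symmetric relation on spacetime indices it suffices to treat the pairs
`(0, i)` and `(j, k)` for cyclic triples `(i, j, k)`, and the diagonal. -/
theorem forall₂ {P : Fin 4 → Fin 4 → Prop} (hself : ∀ α, P α α)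
    (hswap : ∀ α β, P α β → P β α)
    (htime : ∀ i j k, IsCyclicTriple i j k → P 0 i)
    (hspace : ∀ i j k, IsCyclicTriple i j k → P j k) (α β : Fin 4) : P α β := by
  have h₁ : IsCyclicTriple 1 2 3 := by simp [IsCyclicTriple]
  have h₂ := h₁.rotate
  have h₃ := h₂.rotate
  have t₁ := htime _ _ _ h₁
  have t₂ := htime _ _ _ h₂
  have t₃ := htime _ _ _ h₃
  have s₁ := hspace _ _ _ h₁
  have s₂ := hspace _ _ _ h₂
  have s₃ := hspace _ _ _ h₃
  fin_cases α <;> fin_cases β <;> first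
    | exact hself _
    | assumption
    | exact hswap _ _ (by assumption)

end IsCyclicTriple

/-- The transport equation for the specific vorticity, at the level of derivatives at a point:
`w a b`, `w₂ a b d`, `r a`, `q a`, `q₂ a b` stand for `∂_a v^b`, `∂_d ∂_a v^b`, `∂_a ρ`,
`∂_a p`, `∂_b ∂_a p`, and `E`, `R`, `K`, `P` for `e^{-ρ}`, `ϱ̄⁻¹`, `c⁻²`, `p_{;s} / ϱ̄`. -/
theorem specificVorticity_transport_of_jet {i j k : Fin 4} (B A r σ q om : Fin 4 → ℝ)
    (w q₂ dom : Fin 4 → Fin 4 → ℝ) (w₂ : Fin 4 → Fin 4 → Fin 4 → ℝ) (E R K P : ℝ)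
    (hB : B 0 = 1) (hw0 : ∀ a, w a 0 = 0)
    (hr : r 0 + B i * r i + B j * r j + B k * r k = -(w i i + w j j + w k k))
    (hq : ∀ a, a ≠ 0 → A a = -(E * R * q a))
    (hrA : ∀ a, a ≠ 0 → r a = -K * (A a + E * P * σ a))
    (hj : j ≠ 0) (hk : k ≠ 0)
    (hw₂ : ∀ a b d, w₂ a b d = w₂ d b a) (hq₂ : ∀ a b, q₂ a b = q₂ b a)
    (hdw : ∀ a d, a ≠ 0 →
      w d 0 * w 0 a + w d i * w i a + w d j * w j a + w d k * w k a
        + (B 0 * w₂ 0 a d + B i * w₂ i a d + B j * w₂ j a d + B k * w₂ k a d)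
        = E * R * (r d * q a - q₂ a d))
    (hi' : om i = E * (w j k - w k j)) (hj' : om j = E * (w k i - w i k))
    (hk' : om k = E * (w i j - w j i))
    (hdom : ∀ d, dom d i = -r d * om i + E * (w₂ j k d - w₂ k j d)) :
    dom 0 i + B i * dom i i + B j * dom j i + B k * dom k i
      = om i * w i i + om j * w j i + om k * w k i
        - E ^ 2 * K * P * (A j * σ k - A k * σ j) := by
  have h1 := hdw k j hk
  have h2 := hdw j k hj
  simp only [hw0, hB, hdom, hi', hj', hk', zero_mul, zero_add, one_mul] at h1 h2 ⊢
  rw [hw₂ 0 k j, hw₂ i k j, hw₂ k k j] at h1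
  rw [hw₂ 0 j k, hw₂ i j k, hw₂ j j k] at h2
  linear_combination E * h1 - E * h2 - E * (w j k - w k j) * hr + E * r j * hq k hk
    - E * r k * hq j hj - E * A k * hrA j hj + E * A j * hrA k hk - E ^ 2 * R * hq₂ k j

/-- For smooth solutions of the compressible Euler equations,
the exterior derivative of the `g`-dual of the specific vorticity `Ω` is given
by the stated combination of lower-order terms, null-form terms, and the
modified fluid variable `C`. -/
theorem stmt12_exterior_derivative_of_dual_specific_vorticity
    (U : Set (Fin 4 → ℝ)) (hUopen : IsOpen U) (hUne : U.Nonempty)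
    (ρ s : (Fin 4 → ℝ) → ℝ) (v : (Fin 4 → ℝ) → Fin 4 → ℝ)
    (hρ : ContDiffOn ℝ (⊤ : ℕ∞) ρ U) (hs : ContDiffOn ℝ (⊤ : ℕ∞) s U)
    (hv : ContDiffOn ℝ (⊤ : ℕ∞) v U) (hv0 : ∀ x, v x 0 = 0)
    (p : ℝ → ℝ → ℝ) (rhob : ℝ) (hrhob : 0 < rhob)
    (hp : ContDiffOn ℝ (⊤ : ℕ∞) (fun q : ℝ × ℝ => p q.1 q.2)
      (Set.Ioi (0 : ℝ) ×ˢ (Set.univ : Set ℝ)))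
    (hpmono : ∀ r ∈ Set.Ioi (0 : ℝ), ∀ t : ℝ, 0 < deriv (fun r' => p r' t) r)
    (c ps : (Fin 4 → ℝ) → ℝ)
    (hcdef : ∀ x, c x = Real.sqrt (deriv (fun r' => p r' (s x)) (rhob * Real.exp (ρ x))))
    (hpsdef : ∀ x, ps x = deriv (fun t => p (rhob * Real.exp (ρ x)) t) (s x))
    (heulρ : ∀ x ∈ U,
      (∑ μ : Fin 4, Bvec (v x) μ * pd ρ μ x) = -∑ a ∈ spIdx, pd (fun y => v y a) a x)
    (heulv : ∀ x ∈ U, ∀ i : Fin 4, i ≠ 0 →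
      (∑ μ : Fin 4, Bvec (v x) μ * pd (fun y => v y i) μ x)
        = -(c x ^ 2) * pd ρ i x - Real.exp (-(ρ x)) * (ps x / rhob) * pd s i x)
    (heuls : ∀ x ∈ U, (∑ μ : Fin 4, Bvec (v x) μ * pd s μ x) = 0)
    (Ω S C : (Fin 4 → ℝ) → Fin 4 → ℝ)
    (hΩ : ∀ x, ∀ i : Fin 4, Ω x i = if i = 0 then 0 else
      Real.exp (-(ρ x)) * ∑ a : Fin 4, ∑ b : Fin 4, eps3 i a b * pd (fun y => v y b) a x)
    (hS : ∀ x, ∀ i : Fin 4, S x i = if i = 0 then 0 else pd s i x)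
    (hC : ∀ x, ∀ i : Fin 4, C x i = if i = 0 then 0 else
      Real.exp (-(ρ x)) *
          (∑ a : Fin 4, ∑ b : Fin 4, eps3 i a b * pd (fun y => Ω y b) a x)
        + Real.exp (-(3 * ρ x)) / c x ^ 2 * (ps x / rhob) *
            ((∑ a ∈ spIdx, S x a * pd (fun y => v y i) a x)
              - (∑ a ∈ spIdx, pd (fun y => v y a) a x) * S x i)) :
    ∀ x ∈ U, ∀ α β : Fin 4,
      pd (fun y => glow (c y) (v y) (Ω y) β) α x
        - pd (fun y => glow (c y) (v y) (Ω y) α) β x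
      = 2 * pd (fun y => Real.log (c y)) β x * glow (c x) (v x) (Ω x) α
        - 2 * pd (fun y => Real.log (c y)) α x * glow (c x) (v x) (Ω x) β
        + 2 * (if α = 0 then (1 : ℝ) else 0) *
            (∑ a ∈ spIdx, glow (c x) (v x) (Ω x) a * pd (fun y => v y a) β x)
        - 2 * (if β = 0 then (1 : ℝ) else 0) *
            (∑ a ∈ spIdx, glow (c x) (v x) (Ω x) a * pd (fun y => v y a) α x)
        - Real.exp (-(2 * ρ x)) / c x ^ 4 * (ps x / rhob) *
            (∑ γ : Fin 4, ∑ δ : Fin 4, eps4 α β γ δ *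
              (∑ μ : Fin 4, Bvec (v x) μ * pd (fun y => v y γ) μ x) * S x δ)
        + Real.exp (-(2 * ρ x)) / c x ^ 4 * (ps x / rhob) *
            (∑ γ : Fin 4, ∑ δ : Fin 4, eps4 α β γ δ * Bvec (v x) γ *
              (S x δ * (∑ a ∈ spIdx, pd (fun y => v y a) a x)
                - ∑ a ∈ spIdx, S x a * pd (fun y => v y δ) a x))
        + Real.exp (ρ x) / c x ^ 2 *
            (∑ γ : Fin 4, ∑ δ : Fin 4, eps4 α β γ δ * Bvec (v x) γ * C x δ) := by
  have diff {f : (Fin 4 → ℝ) → ℝ} (hf : ContDiffOn ℝ (⊤ : ℕ∞) f U) {y : Fin 4 → ℝ}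
      (hy : y ∈ U) : DifferentiableAt ℝ f y := differentiableAt_of_contDiffOn_top hUopen hf hy
  have hvi (i : Fin 4) : ContDiffOn ℝ (⊤ : ℕ∞) (fun y => v y i) U := contDiffOn_pi.1 hv i
  have hw (a i : Fin 4) : ContDiffOn ℝ (⊤ : ℕ∞) (pd (fun y => v y i) a) U :=
    contDiffOn_pd hUopen (hvi i) a
  have hw0 (a : Fin 4) (y : Fin 4 → ℝ) : pd (fun y => v y 0) a y = 0 := by
    simp [pd, hv0]
  have hr : ContDiffOn ℝ (⊤ : ℕ∞) (fun y => rhob * Real.exp (ρ y)) U :=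
    contDiffOn_const.mul hρ.exp
  have hmaps : Set.MapsTo (fun y => (rhob * Real.exp (ρ y), s y)) U
      (Set.Ioi (0 : ℝ) ×ˢ (Set.univ : Set ℝ)) := fun y _ =>
    ⟨mul_pos hrhob (Real.exp_pos _), Set.mem_univ _⟩
  -- the pressure as a function on spacetime
  set Q : (Fin 4 → ℝ) → ℝ := fun y => p (rhob * Real.exp (ρ y)) (s y) with hQdef
  have hQ : ContDiffOn ℝ (⊤ : ℕ∞) Q U := hp.comp (hr.prodMk hs) hmaps
  have hc2pos (y : Fin 4 → ℝ) : 0 < deriv (fun r' => p r' (s y)) (rhob * Real.exp (ρ y)) :=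
    hpmono _ (mul_pos hrhob (Real.exp_pos _)) _
  have hcpos (y : Fin 4 → ℝ) : 0 < c y := by
    rw [hcdef]
    exact Real.sqrt_pos.2 (hc2pos y)
  have hcsq (y : Fin 4 → ℝ) :
      deriv (fun r' => p r' (s y)) (rhob * Real.exp (ρ y)) = c y ^ 2 := by
    rw [hcdef, Real.sq_sqrt (hc2pos y).le]
  have hc : ContDiffOn ℝ (⊤ : ℕ∞) c U := by
    rw [funext hcdef]
    exact ((contDiffOn_deriv_fst hp).comp (hr.prodMk hs) hmaps).sqrt fun y _ => (hc2pos y).ne'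
  have hdr {y : Fin 4 → ℝ} (hy : y ∈ U) (a : Fin 4) :
      pd (fun y => rhob * Real.exp (ρ y)) a y = rhob * Real.exp (ρ y) * pd ρ a y :=
    pd_comp ((Real.hasDerivAt_exp (ρ y)).const_mul rhob) (diff hρ hy) a
  have hdQ {y : Fin 4 → ℝ} (hy : y ∈ U) (a : Fin 4) :
      pd Q a y = c y ^ 2 * (rhob * Real.exp (ρ y) * pd ρ a y) + ps y * pd s a y := by
    rw [hQdef, pd_comp₂ (p := p) (f := fun y => rhob * Real.exp (ρ y)) ?_ (diff hr hy)
      (diff hs hy), hdr hy, hcsq, ← hpsdef]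
    exact (hp.contDiffAt ((isOpen_Ioi.prod isOpen_univ).mem_nhds (hmaps hy))).differentiableAt
      (by simp)
  have hexp : ContDiffOn ℝ (⊤ : ℕ∞) (fun y => Real.exp (-ρ y)) U := hρ.neg.exp
  have hdexp {y : Fin 4 → ℝ} (hy : y ∈ U) (a : Fin 4) :
      pd (fun y => Real.exp (-ρ y)) a y = -Real.exp (-ρ y) * pd ρ a y :=
    pd_comp (by simpa using (hasDerivAt_neg (ρ y)).exp) (diff hρ hy) a
  have hmom (y : Fin 4 → ℝ) (hy : y ∈ U) (i : Fin 4) (hi : i ≠ 0) :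
      ∑ μ, Bvec (v y) μ * pd (fun y => v y i) μ y
        = -rhob⁻¹ * (Real.exp (-ρ y) * pd Q i y) := by
    rw [heulv y hy i hi, hdQ hy, Real.exp_neg]
    have := Real.exp_ne_zero (ρ y)
    field_simp
    ring
  intro x hx
  have hdmom (a d : Fin 4) (ha : a ≠ 0) :
      ∑ μ, (pd (fun y => v y μ) d x * pd (fun y => v y a) μ x
          + Bvec (v x) μ * pd (pd (fun y => v y a) μ) d x)
        = Real.exp (-ρ x) * rhob⁻¹ * (pd ρ d x * pd Q a x - pd (pd Q a) d x) := by
    have hBd (μ : Fin 4) : DifferentiableAt ℝ (fun y => Bvec (v y) μ) x :=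
      (differentiableAt_const _).add (diff (hvi μ) hx)
    have hdB (μ : Fin 4) : pd (fun y => Bvec (v y) μ) d x = pd (fun y => v y μ) d x := by
      simp [pd, Bvec]
    have hdQa := diff (contDiffOn_pd hUopen hQ a) hx
    have h := pd_congr_of_isOpen hUopen (fun y hy => hmom y hy a ha) hx d
    have hterm (μ : Fin 4) :
        DifferentiableAt ℝ (fun y => Bvec (v y) μ * pd (fun y => v y a) μ y) x :=
      (hBd μ).fun_mul (diff (hw μ a) hx)
    rw [pd_sum _ fun μ _ => hterm μ, pd_mul (differentiableAt_const _) ((diff hexp hx).fun_mul hdQa),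
      pd_mul (diff hexp hx) hdQa, hdexp hx] at h
    simp only [pd_mul (hBd _) (diff (hw _ a) hx), hdB] at h
    rw [h]
    simp [pd]
    ring
  have hΩ0 (y : Fin 4 → ℝ) : Ω y 0 = 0 := by simp [hΩ]
  have hΩi {i j k : Fin 4} (h : IsCyclicTriple i j k) (y : Fin 4 → ℝ) :
      Ω y i = Real.exp (-ρ y) * (pd (fun y => v y k) j y - pd (fun y => v y j) k y) := by
    rw [hΩ, if_neg h.ne_zero, h.sum_eps3]
  have hΩd {i j k : Fin 4} (h : IsCyclicTriple i j k) : DifferentiableAt ℝ (fun y => Ω y i) x := by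
    rw [funext (hΩi h)]
    exact (diff hexp hx).mul ((diff (hw _ _) hx).fun_sub (diff (hw _ _) hx))
  have hdΩ {i j k : Fin 4} (h : IsCyclicTriple i j k) (d : Fin 4) :
      pd (fun y => Ω y i) d x = -pd ρ d x * Ω x i
        + Real.exp (-ρ x) * (pd (pd (fun y => v y k) j) d x - pd (pd (fun y => v y j) k) d x) := by
    rw [funext (hΩi h), pd_mul (diff hexp hx) ((diff (hw _ _) hx).fun_sub (diff (hw _ _) hx)),
      pd_sub (diff (hw _ _) hx) (diff (hw _ _) hx), hdexp hx, hΩi h]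
    ring
  have hdlog (d : Fin 4) : pd (fun y => Real.log (c y)) d x = (c x)⁻¹ * pd c d x :=
    pd_comp (Real.hasDerivAt_log (hcpos x).ne') (diff hc hx) d
  have hKd : DifferentiableAt ℝ (fun y => (c y ^ 2)⁻¹) x :=
    ((diff hc hx).pow 2).inv (pow_ne_zero 2 (hcpos x).ne')
  have hdK (d : Fin 4) :
      pd (fun y => (c y ^ 2)⁻¹) d x
        = -2 * (c x ^ 2)⁻¹ * pd (fun y => Real.log (c y)) d x := by
    have hc0 := (hcpos x).ne'
    rw [hdlog, pd_comp (((hasDerivAt_id' (c x)).fun_pow 2).fun_inv (pow_ne_zero 2 hc0)) (diff hc hx) d]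
    simp
    field_simp
  have hB0 : Bvec (v x) 0 = 1 := by simp [Bvec, hv0]
  have hBi {i : Fin 4} (hi : i ≠ 0) : Bvec (v x) i = v x i := by simp [Bvec, hi]
  set A : Fin 4 → ℝ := fun i => ∑ μ, Bvec (v x) μ * pd (fun y => v y i) μ x with hA
  have htransport {i j k : Fin 4} (h : IsCyclicTriple i j k) :
      pd (fun y => Ω y i) 0 x + v x i * pd (fun y => Ω y i) i x
          + v x j * pd (fun y => Ω y i) j x + v x k * pd (fun y => Ω y i) k x
        = Ω x i * pd (fun y => v y i) i x + Ω x j * pd (fun y => v y i) j x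
          + Ω x k * pd (fun y => v y i) k x
          - Real.exp (-ρ x) ^ 2 * (c x ^ 2)⁻¹ * (ps x / rhob)
            * (A j * pd s k x - A k * pd s j x) := by
    have hi := h.ne_zero
    have hj := h.rotate.ne_zero
    have hk := h.rotate.rotate.ne_zero
    rw [← hBi hi, ← hBi hj, ← hBi hk]
    refine specificVorticity_transport_of_jet (Bvec (v x)) A (fun a => pd ρ a x)
      (fun a => pd s a x) (fun a => pd Q a x) (Ω x) (fun a b => pd (fun y => v y b) a x)
      (fun a b => pd (pd Q a) b x) (fun a b => pd (fun y => Ω y b) a x)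
      (fun a b d => pd (pd (fun y => v y b) a) d x) (Real.exp (-ρ x)) rhob⁻¹ (c x ^ 2)⁻¹
      (ps x / rhob) hB0 (fun a => hw0 a x) ?_ ?_ ?_ hj hk
      (fun a b d => pd_comm hUopen (hvi b) hx a d) (fun a b => pd_comm hUopen hQ hx a b)
      ?_ (hΩi h x) (hΩi h.rotate x) (hΩi h.rotate.rotate x) (fun d => hdΩ h d)
    · have := heulρ x hx
      rw [h.sum_univ, h.sum_spIdx, hB0, one_mul] at this
      exact this
    · intro a ha
      simp only [hA]
      rw [hmom x hx a ha]
      ring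
    · intro a ha
      simp only [hA]
      rw [heulv x hx a ha]
      have := (hcpos x).ne'
      field_simp
      ring
    · intro a d ha
      rw [← hdmom a d ha, h.sum_univ]
      ring
  have hS0 : S x 0 = 0 := by simp [hS]
  have hSi {i : Fin 4} (hi : i ≠ 0) : S x i = pd s i x := by simp [hS, hi]
  have hC0 : C x 0 = 0 := by simp [hC]
  have hCi {i j k : Fin 4} (h : IsCyclicTriple i j k) :
      Real.exp (ρ x) * C x i = pd (fun y => Ω y k) j x - pd (fun y => Ω y j) k x
        + Real.exp (-ρ x) ^ 2 * (c x ^ 2)⁻¹ * (ps x / rhob)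
          * ((∑ a ∈ spIdx, S x a * pd (fun y => v y i) a x)
              - (∑ a ∈ spIdx, pd (fun y => v y a) a x) * S x i) := by
    have hE : Real.exp (ρ x) * Real.exp (-ρ x) = 1 := by rw [← Real.exp_add]; simp
    have hE3 : Real.exp (-(3 * ρ x)) = Real.exp (-ρ x) ^ 3 := by
      rw [← Real.exp_nat_mul]; congr 1; push_cast; ring
    rw [hC, if_neg h.ne_zero, h.sum_eps3, hE3]
    linear_combination (pd (fun y => Ω y k) j x - pd (fun y => Ω y j) k x
        + Real.exp (-ρ x) ^ 2 * (c x ^ 2)⁻¹ * (ps x / rhob)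
          * ((∑ a ∈ spIdx, S x a * pd (fun y => v y i) a x)
              - (∑ a ∈ spIdx, pd (fun y => v y a) a x) * S x i)) * hE
  have hE2 : Real.exp (-(2 * ρ x)) = Real.exp (-ρ x) ^ 2 := by
    rw [← Real.exp_nat_mul]; congr 1; push_cast; ring
  have hglow {i j k : Fin 4} (h : IsCyclicTriple i j k) (y : Fin 4 → ℝ) :
      glow (c y) (v y) (Ω y) i = Ω y i * (c y ^ 2)⁻¹ :=
    glow_of_ne_zero _ _ _ (hΩ0 y) h.ne_zero
  have hdglow {i j k : Fin 4} (h : IsCyclicTriple i j k) (d : Fin 4) :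
      pd (fun y => glow (c y) (v y) (Ω y) i) d x
        = (pd (fun y => Ω y i) d x - 2 * Ω x i * pd (fun y => Real.log (c y)) d x)
          * (c x ^ 2)⁻¹ := by
    rw [funext (hglow h), pd_mul (hΩd h) hKd, hdK]
    ring
  have hdglow0 {i j k : Fin 4} (h : IsCyclicTriple i j k) (d : Fin 4) :
      pd (fun y => glow (c y) (v y) (Ω y) 0) d x
        = -(pd (fun y => v y i) d x * Ω x i + v x i * pd (fun y => Ω y i) d x
            + (pd (fun y => v y j) d x * Ω x j + v x j * pd (fun y => Ω y j) d x)
            + (pd (fun y => v y k) d x * Ω x k + v x k * pd (fun y => Ω y k) d x)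
            - 2 * (v x i * Ω x i + v x j * Ω x j + v x k * Ω x k)
              * pd (fun y => Real.log (c y)) d x) * (c x ^ 2)⁻¹ := by
    have hf (y : Fin 4 → ℝ) : glow (c y) (v y) (Ω y) 0
        = (v y i * Ω y i + v y j * Ω y j + v y k * Ω y k) * (-1 * (c y ^ 2)⁻¹) := by
      rw [h.glow_zero _ _ _ (hΩ0 y)]
      ring
    have hi := (diff (hvi i) hx).fun_mul (hΩd h)
    have hj := (diff (hvi j) hx).fun_mul (hΩd h.rotate)
    have hk := (diff (hvi k) hx).fun_mul (hΩd h.rotate.rotate)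
    have hneg : pd (fun y => -1 * (c y ^ 2)⁻¹) d x = -1 * pd (fun y => (c y ^ 2)⁻¹) d x := by
      rw [pd_mul (differentiableAt_const _) hKd]
      simp [pd]
    rw [funext hf, pd_mul ((hi.fun_add hj).fun_add hk) ((differentiableAt_const _).fun_mul hKd), hneg, hdK,
      pd_add (hi.fun_add hj) hk, pd_add hi hj, pd_mul (diff (hvi i) hx) (hΩd h),
      pd_mul (diff (hvi j) hx) (hΩd h.rotate), pd_mul (diff (hvi k) hx) (hΩd h.rotate.rotate)]
    ring
  refine IsCyclicTriple.forall₂ (fun α => ?_) (fun α β h => ?_) (fun i j k h => ?_)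
    (fun i j k h => ?_)
  · simp [eps4_self]
  · simp only [eps4_swap α β, neg_mul, Finset.sum_neg_distrib]
    linear_combination -h
  · have hi := h.ne_zero
    have hj := h.rotate.ne_zero
    have hk := h.rotate.rotate.ne_zero
    have ht := htransport h
    have hCj := hCi h.rotate
    have hCk := hCi h.rotate.rotate
    simp only [hA, h.sum_spIdx, hSi hi, hSi hj, hSi hk] at ht hCj hCk
    have hw1 : Ω x j * (pd (fun y => v y j) i x - pd (fun y => v y i) j x)
        + Ω x k * (pd (fun y => v y k) i x - pd (fun y => v y i) k x) = 0 := by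
      rw [hΩi h.rotate, hΩi h.rotate.rotate]
      ring
    simp only [mul_assoc, h.sum_eps4_zero, hdglow h, hdglow0 h]
    simp only [hglow h, hglow h.rotate, hglow h.rotate.rotate,
      h.glow_zero _ _ _ (hΩ0 x), h.sum_spIdx, hSi hi, hSi hj, hSi hk, hBi hj, hBi hk, hE2, if_true,
      if_neg hi]
    linear_combination (c x ^ 2)⁻¹ * ht - (c x ^ 2)⁻¹ * hw1
      - (c x ^ 2)⁻¹ * v x j * hCk + (c x ^ 2)⁻¹ * v x k * hCj
  · have hi := h.ne_zero
    have hj := h.rotate.ne_zero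
    have hk := h.rotate.rotate.ne_zero
    have hCi' := hCi h
    simp only [h.sum_spIdx, hSi hi, hSi hj, hSi hk] at hCi'
    simp only [mul_assoc, h.sum_eps4, hdglow h.rotate, hdglow h.rotate.rotate]
    simp only [hglow h.rotate, hglow h.rotate.rotate,
      h.sum_spIdx, hSi hi, hSi hj, hSi hk, hS0, hC0, hB0, hw0, hE2, mul_zero, Finset.sum_const_zero, if_neg hj, if_neg hk]
    linear_combination -(c x ^ 2)⁻¹ * hCi'
end
end

section
/- Let (ρ, v, s) be a smooth solution of the compressible Euler equations on U, and let N̲, H̲, P, 𝒴₁, 𝒴₂, 𝒴₃ be ℝ^4-valued vectorfields on U such that N̲^0 = 1, P^0 = 0, and for each a ∈ {1,2,3} the decomposition e_a = -N̲_a B + P_a H̲ + 𝒴_a holds at every point, where e_a is the a-th standard basis vector of ℝ^4, N̲_α := g_{αμ} N̲^μ, and P_α := g_{αμ} P^μ. Set ν̲² := -g(N̲,N̲). Then at every point of U: ν̲² (Bρ) = -[ Σ_a P_a (H̲ v^a) + (Σ_a N̲_a P^a)(H̲ ρ) + Σ_a (𝒴_a v^a) + c² Σ_a N̲_a (𝒴_a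 ρ) + e^{-ρ} (p_{;s}/ϱ̄) Σ_a N̲_a S^a ], where Xf := X^μ ∂_μ f for a vectorfield X and scalar f, and 𝒴_a v^a := Σ_a (𝒴_a)^μ ∂_μ v^a. -/
noncomputable section

open scoped BigOperators

/-- Lowering a spatial index: `X_a = c⁻² (X^a - v^a X^0)`. -/
lemma glow_spatial (c : ℝ) (v X : Fin 4 → ℝ) {a : Fin 4} (ha : a ≠ 0) :
    glow c v X a = (X a - v a * X 0) / c ^ 2 := by
  fin_cases a
  · exact absurd rfl ha
  all_goals
    simp [glow, gmet, Fin.sum_univ_four]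
    ring

/-- Index lowering is inverted by `c²` on spatial fields: `X^a = c² X_a` when `X^0 = 0`. -/
lemma eq_sq_mul_glow {c : ℝ} (hc : c ≠ 0) (v : Fin 4 → ℝ) {X : Fin 4 → ℝ} (hX : X 0 = 0)
    {a : Fin 4} (ha : a ≠ 0) : X a = c ^ 2 * glow c v X a := by
  rw [glow_spatial c v X ha, hX]
  field_simp
  ring

/-- The acoustical norm in terms of lowered spatial components:
`g(X,X) = -1 + c² Σ_a (X_a)²` when `X^0 = 1`. -/
lemma gip_self_eq {c : ℝ} (hc : c ≠ 0) (v : Fin 4 → ℝ) {X : Fin 4 → ℝ} (hX : X 0 = 1) :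
    gip c v X X = -1 + c ^ 2 * ∑ a ∈ spIdx, glow c v X a ^ 2 := by
  have h1 := glow_spatial c v X (a := 1) (by decide)
  have h2 := glow_spatial c v X (a := 2) (by decide)
  have h3 := glow_spatial c v X (a := 3) (by decide)
  simp [gip, gmet, spIdx, Fin.sum_univ_four, h1, h2, h3, hX]
  field_simp
  ring

/-- Pairing a decomposition of the `a`-th standard basis vector with a covector `f`. -/
lemma apply_eq_of_single_eq {a : Fin 4} {n q : ℝ} {B H Y : Fin 4 → ℝ}
    (h : ∀ μ, (if μ = a then (1 : ℝ) else 0) = -n * B μ + q * H μ + Y μ) (f : Fin 4 → ℝ) :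
    f a = -n * ∑ μ, B μ * f μ + q * ∑ μ, H μ * f μ + ∑ μ, Y μ * f μ := by
  calc f a = ∑ μ, (if μ = a then (1 : ℝ) else 0) * f μ := by simp
    _ = _ := by
      simp only [h, Finset.mul_sum, ← Finset.sum_add_distrib]
      exact Finset.sum_congr rfl fun μ _ => by ring

/-- For smooth solutions of the compressible Euler equations,
with the decomposition `eₐ = -N̲ₐ B + Pₐ H̲ + 𝒴ₐ` (with `N̲⁰ = 1`, `P⁰ = 0`),
the quantity `ν̲² (Bρ)` can be expressed solely through the directional
derivatives `H̲v`, `H̲ρ`, `𝒴ₐv`, `𝒴ₐρ` and the entropy gradient: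
`ν̲²(Bρ) = -[ΣₐPₐ(H̲vᵃ) + (ΣₐN̲ₐPᵃ)(H̲ρ) + Σₐ(𝒴ₐvᵃ) + c²ΣₐN̲ₐ(𝒴ₐρ)
            + e^{-ρ}(p_{;s}/ϱ̄)ΣₐN̲ₐSᵃ]`. -/
theorem stmt14_transport_of_log_density_is_tangential
    (U : Set (Fin 4 → ℝ)) (hUopen : IsOpen U) (hUne : U.Nonempty)
    (ρ s : (Fin 4 → ℝ) → ℝ) (v : (Fin 4 → ℝ) → Fin 4 → ℝ)
    (hρ : ContDiffOn ℝ (⊤ : ℕ∞) ρ U) (hs : ContDiffOn ℝ (⊤ : ℕ∞) s U)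
    (hv : ContDiffOn ℝ (⊤ : ℕ∞) v U) (hv0 : ∀ x, v x 0 = 0)
    (p : ℝ → ℝ → ℝ) (rhob : ℝ) (hrhob : 0 < rhob)
    (hp : ContDiffOn ℝ (⊤ : ℕ∞) (fun q : ℝ × ℝ => p q.1 q.2)
      (Set.Ioi (0 : ℝ) ×ˢ (Set.univ : Set ℝ)))
    (hpmono : ∀ r ∈ Set.Ioi (0 : ℝ), ∀ t : ℝ, 0 < deriv (fun r' => p r' t) r)
    (c ps : (Fin 4 → ℝ) → ℝ)
    (hcdef : ∀ x, c x = Real.sqrt (deriv (fun r' => p r' (s x)) (rhob * Real.exp (ρ x))))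
    (hpsdef : ∀ x, ps x = deriv (fun t => p (rhob * Real.exp (ρ x)) t) (s x))
    (heulρ : ∀ x ∈ U,
      (∑ μ : Fin 4, Bvec (v x) μ * pd ρ μ x) = -∑ a ∈ spIdx, pd (fun y => v y a) a x)
    (heulv : ∀ x ∈ U, ∀ i : Fin 4, i ≠ 0 →
      (∑ μ : Fin 4, Bvec (v x) μ * pd (fun y => v y i) μ x)
        = -(c x ^ 2) * pd ρ i x - Real.exp (-(ρ x)) * (ps x / rhob) * pd s i x)
    (heuls : ∀ x ∈ U, (∑ μ : Fin 4, Bvec (v x) μ * pd s μ x) = 0)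
    (S : (Fin 4 → ℝ) → Fin 4 → ℝ)
    (hS : ∀ x, ∀ i : Fin 4, S x i = if i = 0 then 0 else pd s i x)
    (Nb Hb P : (Fin 4 → ℝ) → Fin 4 → ℝ) (Yd : (Fin 4 → ℝ) → Fin 4 → Fin 4 → ℝ)
    (hNb0 : ∀ x ∈ U, Nb x 0 = 1) (hP0 : ∀ x ∈ U, P x 0 = 0)
    (hdec : ∀ x ∈ U, ∀ a : Fin 4, a ≠ 0 → ∀ μ : Fin 4,
      (if μ = a then (1 : ℝ) else 0)
        = -(glow (c x) (v x) (Nb x) a) * Bvec (v x) μ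
          + glow (c x) (v x) (P x) a * Hb x μ + Yd x a μ) :
    ∀ x ∈ U,
      -gip (c x) (v x) (Nb x) (Nb x) * (∑ μ : Fin 4, Bvec (v x) μ * pd ρ μ x)
      = -((∑ a ∈ spIdx, glow (c x) (v x) (P x) a *
              ∑ μ : Fin 4, Hb x μ * pd (fun y => v y a) μ x)
          + (∑ a ∈ spIdx, glow (c x) (v x) (Nb x) a * P x a) *
              (∑ μ : Fin 4, Hb x μ * pd ρ μ x)
          + (∑ a ∈ spIdx, ∑ μ : Fin 4, Yd x a μ * pd (fun y => v y a) μ x)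
          + c x ^ 2 * (∑ a ∈ spIdx, glow (c x) (v x) (Nb x) a *
              ∑ μ : Fin 4, Yd x a μ * pd ρ μ x)
          + Real.exp (-(ρ x)) * (ps x / rhob) *
              (∑ a ∈ spIdx, glow (c x) (v x) (Nb x) a * S x a)) := by
  intro x hx
  have hc : c x ≠ 0 := by
    rw [hcdef]
    exact (Real.sqrt_pos.2 (hpmono _ (mul_pos hrhob (Real.exp_pos _)) _)).ne'
  have key : ∀ a : Fin 4, a ≠ 0 →
      pd (fun y => v y a) a x
        = c x ^ 2 * glow (c x) (v x) (Nb x) a *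
            (-(glow (c x) (v x) (Nb x) a) * (∑ μ : Fin 4, Bvec (v x) μ * pd ρ μ x)
              + ∑ μ : Fin 4, Yd x a μ * pd ρ μ x)
          + glow (c x) (v x) (Nb x) a * P x a * (∑ μ : Fin 4, Hb x μ * pd ρ μ x)
          + Real.exp (-(ρ x)) * (ps x / rhob) * (glow (c x) (v x) (Nb x) a * S x a)
          + glow (c x) (v x) (P x) a * (∑ μ : Fin 4, Hb x μ * pd (fun y => v y a) μ x)
          + ∑ μ : Fin 4, Yd x a μ * pd (fun y => v y a) μ x := by
    intro a ha
    have hva := apply_eq_of_single_eq (hdec x hx a ha) fun μ => pd (fun y => v y a) μ x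
    have hρa := apply_eq_of_single_eq (hdec x hx a ha) fun μ => pd ρ μ x
    have hSa : S x a = pd s a x := by rw [hS, if_neg ha]
    rw [eq_sq_mul_glow hc (v x) (hP0 x hx) ha, hSa]
    linear_combination hva - glow (c x) (v x) (Nb x) a * heulv x hx a ha
      + c x ^ 2 * glow (c x) (v x) (Nb x) a * hρa
  have hdiv := heulρ x hx
  rw [gip_self_eq hc (v x) (hNb0 x hx)]
  have sum_spIdx : ∀ f : Fin 4 → ℝ, ∑ a ∈ spIdx, f a = f 1 + f 2 + f 3 := fun f => by
    simp [spIdx, add_assoc]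
  simp only [sum_spIdx] at hdiv ⊢
  linear_combination hdiv - key 1 (by decide) - key 2 (by decide) - key 3 (by decide)
end
end
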